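/- arXiv:2212.07927 — 4 statements merged into one kernel-verified Lean document; each statement's English description precedes it below -/
import Mathlib

section
/- Let d_i : ℝⁿ → ℝ, i = 1, …, n, be C¹ functions such that d_i depends only on the coordinates x_i and x_{i+1} (and d_n only on x_n), and suppose there exists η₁ > 0 such that for all x ∈ ℝⁿ and all i: ∂d_i/∂x_i(x) > 0, ∂d_i/∂x_{i+1}(x) < 0 (with ∂d_n/∂x_{n+1} := 0), and ∂d_i/∂x_i(x) + ∂d_i/∂x_{i+1}(x) ≥ η₁. Define f : ℝⁿ → ℝⁿ by f(x) := (−d_1(x), …, −d_n(x)) and let J(x) := ∂f/∂x (x) be its Jacobian. Then μ∞(J(x)) ≤ −η₁ for all x ∈ ℝⁿ. -/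
open scoped BigOperators

/-- The operator norm of the matrix `A` induced by the vector norms `νout` (on the
codomain) and `νin` (on the domain): ‖A‖ = max_{νin x = 1} νout (A x). -/
noncomputable def indNorm {ι κ : Type*} [Fintype ι] [Fintype κ]
    (νout : (ι → ℝ) → ℝ) (νin : (κ → ℝ) → ℝ) (A : Matrix ι κ ℝ) : ℝ :=
  sSup ((fun x => νout (A.mulVec x)) '' {x | νin x = 1})

/-- `HasMatMeasure ν A μ` states that the matrix measure of `A` associated with the
vector norm `ν`, i.e. the limit as ε → 0⁺ of (‖I + ε A‖ − 1)/ε (with ‖·‖ the induced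
operator norm), exists and equals `μ`. -/
def HasMatMeasure {ι : Type*} [Fintype ι] [DecidableEq ι]
    (ν : (ι → ℝ) → ℝ) (A : Matrix ι ι ℝ) (μ : ℝ) : Prop :=
  Filter.Tendsto (fun ε : ℝ => (indNorm ν ν (1 + ε • A) - 1) / ε)
    (nhdsWithin 0 (Set.Ioi 0)) (nhds μ)

/-- The partial derivative `∂g/∂x_j` of `g : ℝⁿ → ℝ` at `x`. -/
noncomputable def pd {n : ℕ} (g : (Fin n → ℝ) → ℝ) (j : Fin n) (x : Fin n → ℝ) : ℝ :=
  fderiv ℝ g x (Pi.single j 1)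

/-- The operator norm induced by the sup norm is the largest absolute row sum. -/
theorem indNorm_sup_norm {ι κ : Type*} [Fintype ι] [Nonempty ι] [Fintype κ] [Nonempty κ]
    (A : Matrix ι κ ℝ) :
    indNorm (fun a : ι → ℝ => ‖a‖) (fun a : κ → ℝ => ‖a‖) A =
      Finset.univ.sup' Finset.univ_nonempty (fun i => ∑ j, |A i j|) := by
  refine IsGreatest.csSup_eq ⟨?_, ?_⟩
  · obtain ⟨i, -, hi⟩ := Finset.exists_mem_eq_sup' Finset.univ_nonempty (fun i => ∑ j, |A i j|)
    have hle (k : ι) : ∑ j, |A k j| ≤ ∑ j, |A i j| := by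
      rw [← hi]
      exact Finset.le_sup' (fun i => ∑ j, |A i j|) (Finset.mem_univ k)
    set s : κ → ℝ := fun j => if 0 ≤ A i j then 1 else -1 with hs
    have hs1 (j : κ) : |s j| = 1 := by
      simp only [hs]
      split_ifs <;> simp
    have hmul (j : κ) : A i j * s j = |A i j| := by
      simp only [hs]
      split_ifs with h
      · rw [mul_one, abs_of_nonneg h]
      · rw [mul_neg_one, abs_of_neg (not_le.mp h)]
    refine ⟨s, ?_, ?_⟩
    · refine le_antisymm ((pi_norm_le_iff_of_nonneg zero_le_one).2 fun j => (hs1 j).le) ?_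
      obtain ⟨j⟩ := ‹Nonempty κ›
      exact (hs1 j).ge.trans (norm_le_pi_norm s j)
    · rw [hi]
      refine le_antisymm ((pi_norm_le_iff_of_nonneg (by positivity)).2 fun k => ?_) ?_
      · refine le_trans ?_ (hle k)
        refine (Finset.abs_sum_le_sum_abs _ _).trans (Finset.sum_le_sum fun j _ => ?_)
        rw [abs_mul, hs1, mul_one]
      · refine le_trans (le_of_eq ?_) ((le_abs_self _).trans (norm_le_pi_norm (A.mulVec s) i))
        exact Finset.sum_congr rfl fun j _ => (hmul j).symm
  · rintro _ ⟨x, hx, rfl⟩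
    refine (pi_norm_le_iff_of_nonempty _).2 fun i => ?_
    refine le_trans ?_ (Finset.le_sup' (fun i => ∑ j, |A i j|) (Finset.mem_univ i))
    refine (Finset.abs_sum_le_sum_abs _ _).trans (Finset.sum_le_sum fun j _ => ?_)
    rw [abs_mul]
    have hxj : |x j| ≤ 1 := (norm_le_pi_norm x j).trans_eq hx
    exact mul_le_of_le_one_right (abs_nonneg _) hxj

/-- The matrix measure associated with the sup norm is
`max_i (A i i + ∑_{j ≠ i} |A i j|)`. -/
theorem hasMatMeasure_sup_norm {ι : Type*} [Fintype ι] [DecidableEq ι] [Nonempty ι]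
    (A : Matrix ι ι ℝ) :
    HasMatMeasure (fun a : ι → ℝ => ‖a‖) A
      (Finset.univ.sup' Finset.univ_nonempty
        (fun i => A i i + ∑ j ∈ Finset.univ.erase i, |A i j|)) := by
  refine tendsto_const_nhds.congr' ?_
  have hdiag : ∀ᶠ ε : ℝ in nhdsWithin 0 (Set.Ioi 0), ∀ i, 0 < 1 + ε * A i i := by
    refine Filter.eventually_all.2 fun i => ?_
    have hcont : Continuous fun ε : ℝ => 1 + ε * A i i := by fun_prop
    exact (hcont.continuousAt.eventually_const_lt (by simp)).filter_mono nhdsWithin_le_nhds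
  filter_upwards [hdiag, self_mem_nhdsWithin] with ε hε hpos
  have hpos : 0 < ε := hpos
  have hrow (i : ι) : ∑ j, |(1 + ε • A) i j| =
      1 + ε * (A i i + ∑ j ∈ Finset.univ.erase i, |A i j|) := by
    rw [← Finset.add_sum_erase _ _ (Finset.mem_univ i)]
    have hoff : ∀ j ∈ Finset.univ.erase i, |(1 + ε • A) i j| = ε * |A i j| := by
      intro j hj
      simp [Matrix.one_apply_ne (Finset.ne_of_mem_erase hj).symm, abs_mul, abs_of_pos hpos]
    rw [Finset.sum_congr rfl hoff, ← Finset.mul_sum]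
    simp only [Matrix.add_apply, Matrix.one_apply_eq, Matrix.smul_apply, smul_eq_mul]
    rw [abs_of_pos (hε i)]
    ring
  have hmono : Monotone fun t : ℝ => 1 + ε * t := fun a b hab => by
    dsimp only
    gcongr
  rw [indNorm_sup_norm, funext hrow, eq_div_iff hpos.ne', eq_sub_iff_add_eq, add_comm, mul_comm]
  exact Finset.apply_sup'_eq_sup'_comp _ (fun t : ℝ => 1 + ε * t) fun a b => hmono.map_sup a b

/-- A function that does not change along the `j`-th coordinate has zero `j`-th partial
derivative. -/
theorem pd_eq_zero {n : ℕ} {g : (Fin n → ℝ) → ℝ} {j : Fin n} {x : Fin n → ℝ}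
    (hg : DifferentiableAt ℝ g x) (h : ∀ t : ℝ, g (x + t • Pi.single j 1) = g x) :
    pd g j x = 0 := by
  rw [pd, ← hg.lineDeriv_eq_fderiv, lineDeriv, funext h, deriv_const]

/-- Lemma 1: under the conditions ∂d_i/∂x_i > 0, ∂d_i/∂x_{i+1} < 0
and ∂d_i/∂x_i + ∂d_i/∂x_{i+1} ≥ η₁, the Jacobian `J(x)` of
`f(x) = (−d_1(x), …, −d_n(x))` satisfies `μ∞(J(x)) ≤ −η₁` for all `x`
(here `μ∞` is the matrix measure associated with the sup norm `‖·‖`). -/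
theorem statement3 (n : ℕ) (hn : 0 < n)
    (d : Fin n → (Fin n → ℝ) → ℝ)
    (hd : ∀ i, ContDiff ℝ 1 (d i))
    (hdep : ∀ (i : Fin n) (x y : Fin n → ℝ), x i = y i →
      (∀ h : (i : ℕ) + 1 < n, x ⟨(i : ℕ) + 1, h⟩ = y ⟨(i : ℕ) + 1, h⟩) → d i x = d i y)
    (η₁ : ℝ) (hη₁ : 0 < η₁)
    (hpos : ∀ (i : Fin n) (x : Fin n → ℝ), 0 < pd (d i) i x)
    (hneg : ∀ (i : Fin n) (x : Fin n → ℝ) (h : (i : ℕ) + 1 < n),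
      pd (d i) ⟨(i : ℕ) + 1, h⟩ x < 0)
    (hsum : ∀ (i : Fin n) (x : Fin n → ℝ),
      η₁ ≤ pd (d i) i x + (if h : (i : ℕ) + 1 < n then pd (d i) ⟨(i : ℕ) + 1, h⟩ x else 0)) :
    ∀ x : Fin n → ℝ,
      ∃ μJ : ℝ, HasMatMeasure (fun a : Fin n → ℝ => ‖a‖)
        (fun i j : Fin n => -(pd (d i) j x)) μJ ∧ μJ ≤ -η₁ := by
  intro x
  have : Nonempty (Fin n) := ⟨⟨0, hn⟩⟩
  refine ⟨_, hasMatMeasure_sup_norm _, Finset.sup'_le _ _ fun i _ => ?_⟩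
  have hzero (j : Fin n) (hji : j ≠ i) (hj : (j : ℕ) ≠ i + 1) : pd (d i) j x = 0 := by
    refine pd_eq_zero ((hd i).differentiable one_ne_zero x) fun t => hdep i _ _ ?_ fun h => ?_
    · simp [Pi.single_eq_of_ne hji.symm]
    · have hne : (⟨i + 1, h⟩ : Fin n) ≠ j := fun e => hj (by rw [← e])
      simp [Pi.single_eq_of_ne hne]
  have hi := hsum i x
  by_cases h : (i : ℕ) + 1 < n
  · rw [dif_pos h] at hi
    have hmem : (⟨i + 1, h⟩ : Fin n) ∈ Finset.univ.erase i := by simp [Fin.ext_iff]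
    rw [Finset.sum_eq_single_of_mem _ hmem, abs_of_pos (neg_pos.2 (hneg i x h))]
    · linarith
    · intro j hj hne
      rw [hzero j (Finset.ne_of_mem_erase hj) fun e => hne (Fin.ext e), neg_zero, abs_zero]
  · rw [dif_neg h] at hi
    rw [Finset.sum_eq_zero]
    · linarith
    · intro j hj
      rw [hzero j (Finset.ne_of_mem_erase hj) (by omega), neg_zero, abs_zero]
end

section
/- Let d_i : ℝⁿ → ℝ, i = 1, …, n, be C¹ functions such that d_i depends only on coordinates x_i and x_{i+1} (and d_n only on x_n), with the convention d_0 :≡ 0, and suppose there exists η > 0 such that for all x ∈ ℝⁿ: ∂d_i/∂x_i(x) > 0, ∂d_i/∂x_{i+1}(x) < 0 (with ∂d_n/∂x_{n+1} := 0), ∂d_1/∂x_1(x) + ∂d_1/∂x_2(x) ≥ η, and ∂d_i/∂x_i(x) + ∂d_i/∂x_{i+1}(x) ≤ ∂d_{i+1}/∂x_{i+1}(x) + ∂d_{i+1}/∂x_{i+2}(x) − η for i = 1, …, n − 1. Define f₁ : ℝⁿ → ℝⁿ by (f₁)_i(x) := d_{i−1}(x) − d_i(x) and let J₁(x) := ∂f₁/∂x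 (x). Then μ∞(J₁(x)) ≤ −η for all x ∈ ℝⁿ. -/
open scoped BigOperators

/-- The induced sup norm of an entrywise nonnegative matrix is its largest row sum. -/
theorem indNorm_sup_of_nonneg {ι : Type*} [Fintype ι] (B : Matrix ι ι ℝ)
    (hB : ∀ i j, 0 ≤ B i j) (M : ℝ) (hM : ∀ i, ∑ j, B i j ≤ M) (k : ι) (hk : ∑ j, B k j = M) :
    indNorm (fun a : ι → ℝ => ‖a‖) (fun a : ι → ℝ => ‖a‖) B = M := by
  have hM0 : 0 ≤ M := hk ▸ Finset.sum_nonneg fun j _ => hB k j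
  have : Nonempty ι := ⟨k⟩
  have hle : ∀ x : ι → ℝ, ‖x‖ = 1 → ‖B.mulVec x‖ ≤ M := by
    intro x hx
    refine (pi_norm_le_iff_of_nonneg hM0).2 fun i => ?_
    calc ‖B.mulVec x i‖ ≤ ∑ j, ‖B i j * x j‖ := norm_sum_le _ _
      _ ≤ ∑ j, B i j := by
        refine Finset.sum_le_sum fun j _ => ?_
        rw [norm_mul, Real.norm_of_nonneg (hB i j)]
        exact mul_le_of_le_one_right (hB i j) (hx ▸ norm_le_pi_norm x j)
      _ ≤ M := hM i
  have hone : ‖(1 : ι → ℝ)‖ = 1 := norm_one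
  refine IsGreatest.csSup_eq ⟨⟨1, hone, le_antisymm (hle 1 hone) ?_⟩, ?_⟩
  · calc M = B.mulVec 1 k := by simp [Matrix.mulVec, dotProduct, hk]
      _ ≤ ‖B.mulVec 1 k‖ := Real.le_norm_self _
      _ ≤ ‖B.mulVec 1‖ := norm_le_pi_norm _ k
  · rintro _ ⟨x, hx, rfl⟩
    exact hle x hx

/-- The sup-norm matrix measure of a Metzler matrix is its largest row sum. -/
theorem hasMatMeasure_sup_of_metzler {ι : Type*} [Fintype ι] [DecidableEq ι] (A : Matrix ι ι ℝ)
    (hA : ∀ i j, i ≠ j → 0 ≤ A i j) (M : ℝ) (hM : ∀ i, ∑ j, A i j ≤ M) (k : ι)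
    (hk : ∑ j, A k j = M) : HasMatMeasure (fun a : ι → ℝ => ‖a‖) A M := by
  refine tendsto_const_nhds.congr' ?_
  have hdiag : ∀ i, ∀ᶠ ε : ℝ in nhdsWithin 0 (Set.Ioi 0), 0 < 1 + ε * A i i := by
    intro i
    have hc : Filter.Tendsto (fun ε : ℝ => 1 + ε * A i i) (nhds 0) (nhds (1 + 0 * A i i)) :=
      Continuous.tendsto (by fun_prop) 0
    exact (hc.mono_left nhdsWithin_le_nhds).eventually_const_lt (by simp)
  filter_upwards [Filter.eventually_all.2 hdiag, self_mem_nhdsWithin] with ε hε hpos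
  have hε0 : 0 < ε := hpos
  have hsum : ∀ i, ∑ j, (1 + ε • A) i j = 1 + ε * ∑ j, A i j := by
    intro i
    simp [Finset.sum_add_distrib, Finset.mul_sum, Matrix.one_apply]
  have hnorm : indNorm (fun a : ι → ℝ => ‖a‖) (fun a : ι → ℝ => ‖a‖) (1 + ε • A)
      = 1 + ε * M := by
    refine indNorm_sup_of_nonneg _ (fun i j => ?_) _ (fun i => ?_) k ?_
    · by_cases hij : i = j
      · subst hij
        simpa using (hε i).le
      · simpa [Matrix.one_apply_ne hij] using mul_nonneg hε0.le (hA i j hij)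
    · rw [hsum]
      gcongr
      exact hM i
    · rw [hsum, hk]
  rw [hnorm]
  field_simp
  ring

/-- The partial derivative vanishes along a coordinate the function does not depend on. -/
theorem pd_eq_zero_of_update {n : ℕ} (g : (Fin n → ℝ) → ℝ) (j : Fin n) (x : Fin n → ℝ)
    (hg : DifferentiableAt ℝ g x) (h : ∀ t : ℝ, g (x + t • Pi.single j 1) = g x) :
    pd g j x = 0 := by
  rw [pd, ← hg.lineDeriv_eq_fderiv, lineDeriv, funext h]
  exact deriv_const _ _

/-- under the heterogeneous conditions (16), the Jacobian `J₁(x)` of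
`f₁(x)` with `(f₁)_i = d_{i−1} − d_i` (convention `d_0 ≡ 0`; 0-based indexing), whose
`(i,j)` entry is `∂d_{i−1}/∂x_j − ∂d_i/∂x_j`, satisfies `μ∞(J₁(x)) ≤ −η` for all `x`
(`μ∞` being the matrix measure associated with the sup norm `‖·‖`). -/
theorem statement8 (n : ℕ) (hn : 0 < n)
    (d : Fin n → (Fin n → ℝ) → ℝ)
    (hd : ∀ i, ContDiff ℝ 1 (d i))
    (hdep : ∀ (i : Fin n) (x y : Fin n → ℝ), x i = y i →
      (∀ h : (i : ℕ) + 1 < n, x ⟨(i : ℕ) + 1, h⟩ = y ⟨(i : ℕ) + 1, h⟩) → d i x = d i y)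
    (η : ℝ) (hη : 0 < η)
    (hpos : ∀ (i : Fin n) (x : Fin n → ℝ), 0 < pd (d i) i x)
    (hneg : ∀ (i : Fin n) (x : Fin n → ℝ) (h : (i : ℕ) + 1 < n),
      pd (d i) ⟨(i : ℕ) + 1, h⟩ x < 0)
    (hfirst : ∀ x : Fin n → ℝ,
      η ≤ pd (d ⟨0, hn⟩) ⟨0, hn⟩ x
        + (if h : (0 : ℕ) + 1 < n then pd (d ⟨0, hn⟩) ⟨(0 : ℕ) + 1, h⟩ x else 0))
    (hmono : ∀ (i : Fin n) (h : (i : ℕ) + 1 < n) (x : Fin n → ℝ),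
      pd (d i) i x + pd (d i) ⟨(i : ℕ) + 1, h⟩ x
        ≤ pd (d ⟨(i : ℕ) + 1, h⟩) ⟨(i : ℕ) + 1, h⟩ x
          + (if h' : (i : ℕ) + 2 < n then pd (d ⟨(i : ℕ) + 1, h⟩) ⟨(i : ℕ) + 2, h'⟩ x else 0)
          - η) :
    ∀ x : Fin n → ℝ,
      ∃ μJ : ℝ,
        HasMatMeasure (fun a : Fin n → ℝ => ‖a‖)
          (fun i j : Fin n =>
            (if h : 0 < (i : ℕ) then
              pd (d ⟨(i : ℕ) - 1, Nat.lt_of_le_of_lt (Nat.sub_le _ _) i.isLt⟩) j x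
            else 0) - pd (d i) j x) μJ ∧ μJ ≤ -η := by
  intro x
  have hzero : ∀ i j : Fin n, j ≠ i → (j : ℕ) ≠ (i : ℕ) + 1 → pd (d i) j x = 0 := by
    intro i j hji hji'
    refine pd_eq_zero_of_update _ _ _ ((hd i).differentiable one_ne_zero x) fun t => ?_
    refine hdep i _ _ (by simp [hji.symm]) fun h => ?_
    have hne : (⟨(i : ℕ) + 1, h⟩ : Fin n) ≠ j := fun he => hji' (by rw [← he])
    simp [hne]
  have hsum : ∀ i : Fin n, ∑ j, pd (d i) j x
      = pd (d i) i x + (if h : (i : ℕ) + 1 < n then pd (d i) ⟨(i : ℕ) + 1, h⟩ x else 0) := by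
    intro i
    split_ifs with h
    · refine Fintype.sum_eq_add _ _ (by simp [Fin.ext_iff]) fun j hj => hzero i j hj.1 ?_
      exact fun he => hj.2 (Fin.ext he)
    · rw [add_zero]
      refine Fintype.sum_eq_single _ fun j hj => hzero i j hj ?_
      have := j.isLt
      lia
  generalize hA : (fun i j : Fin n => (if h : 0 < (i : ℕ) then
    pd (d ⟨(i : ℕ) - 1, Nat.lt_of_le_of_lt (Nat.sub_le _ _) i.isLt⟩) j x
      else 0) - pd (d i) j x) = A
  have hmetzler : ∀ i j, i ≠ j → 0 ≤ A i j := by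
    intro i j hij
    have hprev : 0 ≤ if h : 0 < (i : ℕ) then
        pd (d ⟨(i : ℕ) - 1, Nat.lt_of_le_of_lt (Nat.sub_le _ _) i.isLt⟩) j x else 0 := by
      split_ifs with h
      · by_cases hj : j = ⟨(i : ℕ) - 1, Nat.lt_of_le_of_lt (Nat.sub_le _ _) i.isLt⟩
        · rw [hj]
          exact (hpos _ x).le
        · refine (hzero _ j hj ?_).ge
          have := Fin.val_ne_of_ne hij
          simp only
          lia
      · exact le_rfl
    have hnext : pd (d i) j x ≤ 0 := by
      by_cases hj : (j : ℕ) = (i : ℕ) + 1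
      · have hlt : (i : ℕ) + 1 < n := hj ▸ j.isLt
        rw [show j = ⟨(i : ℕ) + 1, hlt⟩ from Fin.ext hj]
        exact (hneg i x hlt).le
      · exact (hzero i j hij.symm hj).le
    rw [← hA]
    exact sub_nonneg.2 (hnext.trans hprev)
  have hrow : ∀ i, ∑ j, A i j ≤ -η := by
    rintro ⟨i, hi⟩
    rw [← hA]
    cases i with
    | zero =>
      have := hfirst x
      have hs := hsum ⟨0, hn⟩
      simp only [lt_irrefl, dite_false, zero_sub, Finset.sum_neg_distrib] at hs ⊢
      linarith
    | succ i =>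
      have hm := hmono ⟨i, Nat.lt_of_succ_lt hi⟩ hi x
      have hs := hsum ⟨i, Nat.lt_of_succ_lt hi⟩
      have hs' := hsum ⟨i + 1, hi⟩
      simp only [dif_pos hi] at hs
      simp only [Nat.succ_pos, dite_true, Finset.sum_sub_distrib, Nat.add_sub_cancel]
      linarith
  have : Nonempty (Fin n) := ⟨⟨0, hn⟩⟩
  obtain ⟨k, hk⟩ := Finite.exists_max fun i => ∑ j, A i j
  exact ⟨_, hasMatMeasure_sup_of_metzler A hmetzler _ hk k rfl, hrow k⟩
end

section
/- Let m ≥ 1 and let B ∈ ℝ^{m×m} be the matrix with B_{ij} = −1 if i = j, B_{ij} = 1 if i = j + 1, and B_{ij} = 0 otherwise. Then the matrix measure of B associated with the Euclidean norm satisfies μ₂(B) = −1 + cos(π / (m + 1)); in particular μ₂(B) < 0 and μ₂(B) is strictly increasing in m. -/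
open scoped BigOperators

open Finset Matrix in
/-- If the Euclidean quadratic form of `A` is bounded above by `c` times the square norm, with
equality at some nonzero vector, then the Euclidean matrix measure of `A` is `c`. -/
theorem hasMatMeasure_euclidean_of_isGreatest {ι : Type*} [Fintype ι] [DecidableEq ι]
    (A : Matrix ι ι ℝ) (c : ℝ) (hle : ∀ x : ι → ℝ, x ⬝ᵥ A *ᵥ x ≤ c * ∑ i, x i ^ 2)
    (v : ι → ℝ) (hv : 0 < ∑ i, v i ^ 2) (heq : v ⬝ᵥ A *ᵥ v = c * ∑ i, v i ^ 2) :
    HasMatMeasure (fun x : ι → ℝ => √(∑ i, x i ^ 2)) A c := by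
  set C : ℝ := ∑ i, ∑ j, A i j ^ 2 with hC
  have hbound (x : ι → ℝ) : ∑ i, (A *ᵥ x) i ^ 2 ≤ C * ∑ i, x i ^ 2 := by
    rw [hC, Finset.sum_mul]
    exact Finset.sum_le_sum fun i _ => Finset.sum_mul_sq_le_sq_mul_sq univ (A i) x
  have hexpand (ε : ℝ) (x : ι → ℝ) : ∑ i, ((1 + ε • A) *ᵥ x) i ^ 2
      = ∑ i, x i ^ 2 + 2 * ε * (x ⬝ᵥ A *ᵥ x) + ε ^ 2 * ∑ i, (A *ᵥ x) i ^ 2 := by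
    simp only [add_mulVec, one_mulVec, smul_mulVec, Pi.add_apply, Pi.smul_apply, smul_eq_mul,
      dotProduct, Finset.mul_sum, ← Finset.sum_add_distrib]
    exact Finset.sum_congr rfl fun i _ => by ring
  obtain ⟨w, hw, hwA⟩ : ∃ w : ι → ℝ, ∑ i, w i ^ 2 = 1 ∧ w ⬝ᵥ A *ᵥ w = c := by
    have hs : √(∑ i, v i ^ 2) ^ 2 = ∑ i, v i ^ 2 := Real.sq_sqrt hv.le
    refine ⟨(√(∑ i, v i ^ 2))⁻¹ • v, ?_, ?_⟩
    · simp only [Pi.smul_apply, smul_eq_mul, mul_pow, ← Finset.mul_sum, inv_pow, hs]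
      exact inv_mul_cancel₀ hv.ne'
    · rw [mulVec_smul, dotProduct_smul, smul_dotProduct, heq, smul_eq_mul, smul_eq_mul,
        ← mul_assoc, ← sq, inv_pow, hs]
      field_simp
  have hupper (ε : ℝ) (hε : 0 < ε) (x : ι → ℝ) (hx : √(∑ i, x i ^ 2) = 1) :
      √(∑ i, ((1 + ε • A) *ᵥ x) i ^ 2) ≤ 1 + ε * c + ε ^ 2 * C / 2 := by
    have hx1 : ∑ i, x i ^ 2 = 1 := Real.sqrt_eq_one.mp hx
    have h1 := hle x
    have h2 := hbound x
    have h3 := hexpand ε x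
    have h0 : 0 ≤ ∑ i, ((1 + ε • A) *ᵥ x) i ^ 2 := Finset.sum_nonneg fun i _ => sq_nonneg _
    rw [hx1, mul_one] at h1 h2
    rw [hx1] at h3
    have h4 := mul_le_mul_of_nonneg_left h1 hε.le
    have h5 := mul_le_mul_of_nonneg_left h2 (sq_nonneg ε)
    nlinarith [Real.sq_sqrt h0, sq_nonneg (√(∑ i, ((1 + ε • A) *ᵥ x) i ^ 2) - 1)]
  have hlower (ε : ℝ) : 1 + ε * c ≤ √(∑ i, ((1 + ε • A) *ᵥ w) i ^ 2) := by
    refine Real.le_sqrt_of_sq_le ?_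
    have h := Finset.sum_mul_sq_le_sq_mul_sq univ w (A *ᵥ w)
    rw [hw, one_mul, show ∑ i, w i * (A *ᵥ w) i = c from hwA] at h
    rw [hexpand, hw, hwA]
    nlinarith [mul_le_mul_of_nonneg_left h (sq_nonneg ε)]
  have hw1 : √(∑ i, w i ^ 2) = 1 := by rw [hw, Real.sqrt_one]
  have hlim : Filter.Tendsto (fun ε : ℝ => c + ε * C / 2) (nhdsWithin 0 (Set.Ioi 0)) (nhds c) := by
    have : Filter.Tendsto (fun ε : ℝ => c + ε * C / 2) (nhds 0) (nhds (c + 0 * C / 2)) :=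
      Continuous.tendsto (by fun_prop) 0
    simp only [zero_mul, zero_div, add_zero] at this
    exact this.mono_left nhdsWithin_le_nhds
  refine tendsto_of_tendsto_of_tendsto_of_le_of_le' tendsto_const_nhds hlim ?_ ?_
  · filter_upwards [self_mem_nhdsWithin] with ε hε
    rw [Set.mem_Ioi] at hε
    have hmem : √(∑ i, ((1 + ε • A) *ᵥ w) i ^ 2)
        ≤ indNorm (fun x : ι → ℝ => √(∑ i, x i ^ 2)) (fun x => √(∑ i, x i ^ 2)) (1 + ε • A) := by
      refine le_csSup ⟨1 + ε * c + ε ^ 2 * C / 2, ?_⟩ ⟨w, hw1, rfl⟩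
      rintro _ ⟨x, hx, rfl⟩
      exact hupper ε hε x hx
    rw [le_div_iff₀ hε]
    linarith [hlower ε]
  · filter_upwards [self_mem_nhdsWithin] with ε hε
    rw [Set.mem_Ioi] at hε
    have hsup : indNorm (fun x : ι → ℝ => √(∑ i, x i ^ 2)) (fun x => √(∑ i, x i ^ 2)) (1 + ε • A)
        ≤ 1 + ε * c + ε ^ 2 * C / 2 := by
      refine csSup_le ⟨_, w, hw1, rfl⟩ ?_
      rintro _ ⟨x, hx, rfl⟩
      exact hupper ε hε x hx
    rw [div_le_iff₀ hε]
    linarith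

theorem sin_add_two_mul_add_sin (θ t : ℝ) :
    Real.sin ((t + 2) * θ) + Real.sin (t * θ) = 2 * Real.cos θ * Real.sin ((t + 1) * θ) := by
  rw [show (t + 2) * θ = (t + 1) * θ + θ by ring, show t * θ = (t + 1) * θ - θ by ring,
    Real.sin_add, Real.sin_sub]
  ring

/-- The path quadratic form is bounded by `cos θ` times the square norm, up to a boundary term. -/
theorem sum_castSucc_mul_succ_add_le (θ : ℝ) (n : ℕ)
    (hs : ∀ k : ℕ, k ≤ n → 0 < Real.sin (((k : ℝ) + 1) * θ)) (x : Fin (n + 1) → ℝ) :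
    ∑ k : Fin n, x k.castSucc * x k.succ
      + Real.sin (((n : ℝ) + 2) * θ) / Real.sin (((n : ℝ) + 1) * θ) / 2 * x (Fin.last n) ^ 2
      ≤ Real.cos θ * ∑ i, x i ^ 2 := by
  induction n with
  | zero =>
    have h := hs 0 le_rfl
    have h2 := sin_add_two_mul_add_sin θ 0
    simp only [Nat.cast_zero, zero_add, zero_mul, Real.sin_zero, add_zero, one_mul] at h h2 ⊢
    rw [h2]
    simp only [Finset.univ_eq_empty, Finset.sum_empty, zero_add]
    rw [Fin.sum_univ_castSucc, Finset.univ_eq_empty, Finset.sum_empty, zero_add]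
    refine le_of_eq ?_
    field_simp
  | succ n ih =>
    have h := ih (fun k hk => hs k (hk.trans n.le_succ)) (fun i => x i.castSucc)
    have h1 := hs n n.le_succ
    have h2 := hs (n + 1) le_rfl
    have h3 := sin_add_two_mul_add_sin θ ((n : ℝ) + 1)
    rw [Fin.sum_univ_castSucc, Fin.sum_univ_castSucc (n := n + 1)]
    push_cast at h2 ⊢
    rw [show (n : ℝ) + 1 + 1 = n + 2 by ring] at h2 h3 ⊢
    simp only [Fin.succ_castSucc] at h ⊢
    rw [Fin.succ_last]
    set a := x (Fin.last n).castSucc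
    set b := x (Fin.last (n + 1))
    set p := Real.sin (((n : ℝ) + 1) * θ)
    set q := Real.sin (((n : ℝ) + 2) * θ)
    set r := Real.sin (((n : ℝ) + 1 + 2) * θ)
    have key : a * b + r / q / 2 * b ^ 2 ≤ q / p / 2 * a ^ 2 + Real.cos θ * b ^ 2 := by
      have hc : Real.cos θ = (r + p) / (2 * q) := by field_simp; linarith
      have : q / p / 2 * a ^ 2 + Real.cos θ * b ^ 2 - (a * b + r / q / 2 * b ^ 2)
          = (q * a - p * b) ^ 2 / (2 * p * q) := by
        rw [hc]; field_simp; ring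
      have : 0 ≤ (q * a - p * b) ^ 2 / (2 * p * q) := by positivity
      linarith
    linarith

theorem sum_sin_mul_sin_add (θ : ℝ) (n : ℕ) :
    ∑ k : Fin n, Real.sin (((k : ℝ) + 1) * θ) * Real.sin (((k : ℝ) + 2) * θ)
      + Real.sin (((n : ℝ) + 2) * θ) * Real.sin (((n : ℝ) + 1) * θ) / 2
      = Real.cos θ * ∑ i : Fin (n + 1), Real.sin (((i : ℝ) + 1) * θ) ^ 2 := by
  induction n with
  | zero =>
    have h := sin_add_two_mul_add_sin θ 0
    simp at h ⊢
    rw [h]; ring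
  | succ n ih =>
    have h := sin_add_two_mul_add_sin θ ((n : ℝ) + 1)
    rw [Fin.sum_univ_castSucc, Fin.sum_univ_castSucc (n := n + 1)]
    simp only [Fin.val_castSucc, Fin.val_last]
    push_cast
    rw [show (n : ℝ) + 1 + 1 = n + 2 by ring] at h ⊢
    linear_combination ih + Real.sin (((n : ℝ) + 2) * θ) / 2 * h

open Matrix in
theorem dotProduct_bidiagonal_mulVec (n : ℕ) (x : Fin (n + 1) → ℝ) :
    x ⬝ᵥ (show Matrix (Fin (n + 1)) (Fin (n + 1)) ℝ from
        fun i j => if (i : ℕ) = (j : ℕ) then -1 else if (i : ℕ) = (j : ℕ) + 1 then 1 else 0) *ᵥ x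
      = -∑ i, x i ^ 2 + ∑ k : Fin n, x k.castSucc * x k.succ := by
  have hrow (i : Fin (n + 1)) : ∑ j : Fin (n + 1), (if (i : ℕ) = (j : ℕ) then (-1 : ℝ)
      else if (i : ℕ) = (j : ℕ) + 1 then 1 else 0) * x j
      = -x i + ∑ j : Fin (n + 1), if (i : ℕ) = (j : ℕ) + 1 then x j else 0 := by
    have hi : -x i = ∑ j : Fin (n + 1), if i = j then -x j else 0 := by simp
    rw [hi, ← Finset.sum_add_distrib]
    refine Finset.sum_congr rfl fun j _ => ?_
    simp only [Fin.ext_iff]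
    split_ifs <;> first | omega | simp
  have hsub : ∑ i : Fin (n + 1), x i * ∑ j : Fin (n + 1), (if (i : ℕ) = (j : ℕ) + 1 then x j else 0)
      = ∑ k : Fin n, x k.castSucc * x k.succ := by
    rw [Fin.sum_univ_succ]
    simp only [Fin.val_zero, Fin.val_succ, add_left_inj, (Nat.succ_ne_zero _).symm, if_false,
      Finset.sum_const_zero, mul_zero, zero_add]
    refine Finset.sum_congr rfl fun k _ => ?_
    rw [Finset.sum_eq_single k.castSucc]
    · simp [mul_comm]
    · intro j _ hj
      exact if_neg fun h => hj (Fin.ext h.symm)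
    · simp
  simp only [dotProduct, mulVec, hrow, mul_add, Finset.sum_add_distrib, hsub]
  congr 1
  rw [← Finset.sum_neg_distrib]
  exact Finset.sum_congr rfl fun i _ => by ring

/-- Example 1: for `m ≥ 1` and `B ∈ ℝ^{m×m}` with `B_{ij} = −1` if
`i = j`, `1` if `i = j + 1`, `0` otherwise, the matrix measure associated with the
Euclidean norm satisfies `μ₂(B) = −1 + cos(π/(m+1))`; in particular `μ₂(B) < 0` and
the value `−1 + cos(π/(m+1))` is strictly increasing in `m`. -/
theorem statement10 (m : ℕ) (hm : 1 ≤ m) :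
    HasMatMeasure (fun x : Fin m → ℝ => Real.sqrt (∑ i, x i ^ 2))
      (fun i j : Fin m => if (i : ℕ) = (j : ℕ) then -1
        else if (i : ℕ) = (j : ℕ) + 1 then 1 else 0)
      (-1 + Real.cos (Real.pi / ((m : ℝ) + 1))) ∧
    (-1 + Real.cos (Real.pi / ((m : ℝ) + 1)) < 0) ∧
    (∀ m₁ m₂ : ℕ, 1 ≤ m₁ → m₁ < m₂ →
      -1 + Real.cos (Real.pi / ((m₁ : ℝ) + 1))
        < -1 + Real.cos (Real.pi / ((m₂ : ℝ) + 1))) := by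
  refine ⟨?_, ?_, fun m₁ m₂ _ h => ?_⟩
  · obtain ⟨n, rfl⟩ : ∃ n, m = n + 1 := ⟨m - 1, by omega⟩
    set θ := Real.pi / (((n + 1 : ℕ) : ℝ) + 1) with hθ
    have hθ0 : 0 < θ := by positivity
    have hθn : ((n : ℝ) + 2) * θ = Real.pi := by
      rw [hθ]; push_cast; field_simp; ring
    have hs (k : ℕ) (hk : k ≤ n) : 0 < Real.sin (((k : ℝ) + 1) * θ) := by
      have hk' : (k : ℝ) ≤ n := by exact_mod_cast hk
      refine Real.sin_pos_of_pos_of_lt_pi (by positivity) ?_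
      rw [← hθn]
      exact mul_lt_mul_of_pos_right (by linarith) hθ0
    refine hasMatMeasure_euclidean_of_isGreatest _ _ (fun x => ?_)
      (fun i => Real.sin (((i : ℝ) + 1) * θ)) ?_ ?_
    · have h := sum_castSucc_mul_succ_add_le θ n hs x
      rw [hθn, Real.sin_pi, zero_div, zero_div, zero_mul, add_zero] at h
      linarith [dotProduct_bidiagonal_mulVec n x]
    · exact Finset.sum_pos (fun i _ => pow_pos (hs i (by omega)) 2) Finset.univ_nonempty
    · have h := sum_sin_mul_sin_add θ n
      rw [hθn, Real.sin_pi, zero_mul, zero_div, add_zero] at h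
      refine (dotProduct_bidiagonal_mulVec n _).trans ?_
      simp only [Fin.val_castSucc, Fin.val_succ, Nat.cast_add, Nat.cast_one, add_assoc,
        one_add_one_eq_two]
      linarith
  · have h : Real.cos (Real.pi / ((m : ℝ) + 1)) < Real.cos 0 :=
      Real.cos_lt_cos_of_nonneg_of_le_pi le_rfl
        (div_le_self Real.pi_pos.le (by linarith [m.cast_nonneg (α := ℝ)])) (by positivity)
    rw [Real.cos_zero] at h
    linarith
  · have h' : (m₁ : ℝ) < m₂ := by exact_mod_cast h
    refine add_lt_add_right (Real.cos_lt_cos_of_nonneg_of_le_pi (by positivity)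
      (div_le_self Real.pi_pos.le (by linarith [m₁.cast_nonneg (α := ℝ)])) ?_) _
    exact div_lt_div_of_pos_left Real.pi_pos (by positivity) (by linarith)
end

section
/- Let n = n₁ + ⋯ + n_m with n_i ≥ 1, and let A ∈ ℝ^{n×n} be partitioned into blocks A^{ij} ∈ ℝ^{n_i × n_j} accordingly. Define B ∈ ℝ^{m×m} by B_{ii} := μ∞(A^{ii}) and B_{ij} := ‖A^{ij}‖∞ for i ≠ j. Then for every positive-definite diagonal matrix D ∈ ℝ^{m×m}, the matrix measure μ_* associated with the composite norm |a|_* := |D (|a¹|∞, …, |aᵐ|∞)ᵀ|₂ (where a = (a¹, …, aᵐ) is the corresponding block decomposition of a ∈ ℝⁿ) satisfies μ_*(A) ≤ μ_{D,2}(B), where μ_{D,2} is the matrix measure associated with the norm |b|_{D,2} := |D b|₂ on ℝᵐ. -/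
open scoped BigOperators

/-- A linear map between finite-dimensional real spaces is bounded with respect to a norm on the
domain and a seminorm on the codomain. -/
theorem Seminorm.exists_bound_of_finiteDimensional {V W : Type*} [AddCommGroup V] [Module ℝ V]
    [FiniteDimensional ℝ V] [AddCommGroup W] [Module ℝ W]
    (p : Seminorm ℝ W) (q : Seminorm ℝ V) (hq : ∀ x, q x = 0 → x = 0) (T : V →ₗ[ℝ] W) :
    ∃ C, 0 ≤ C ∧ ∀ x, p (T x) ≤ C * q x := by
  let : Norm V := ⟨q⟩
  have core : NormedSpace.Core ℝ V :=
    { norm_nonneg := fun x => apply_nonneg q x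
      norm_smul := fun c x => map_smul_eq_mul q c x
      norm_triangle := fun x y => map_add_le_add q x y
      norm_eq_zero_iff := fun x => ⟨hq x, fun h => by rw [h]; exact map_zero q⟩ }
  let : NormedAddCommGroup V := NormedAddCommGroup.ofCore core
  let : NormedSpace ℝ V := NormedSpace.ofCore core
  let : SeminormedAddCommGroup W := p.toAddGroupSeminorm.toSeminormedAddCommGroup
  let : NormedSpace ℝ W := { norm_smul_le := fun c x => (map_smul_eq_mul p c x).le }
  let S : V →L[ℝ] W := ⟨T, T.continuous_of_finiteDimensional⟩
  exact ⟨‖S‖, norm_nonneg _, fun x => S.le_opNorm x⟩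

section IndNorm

variable {ι κ : Type*} [Fintype ι] [Fintype κ]

theorem indNorm_nonneg (p : Seminorm ℝ (ι → ℝ)) (q : (κ → ℝ) → ℝ) (A : Matrix ι κ ℝ) :
    0 ≤ indNorm p q A := by
  apply Real.sSup_nonneg
  rintro _ ⟨x, -, rfl⟩
  exact apply_nonneg p _

theorem indNorm_le {p : (ι → ℝ) → ℝ} {q : (κ → ℝ) → ℝ} {A : Matrix ι κ ℝ} {C : ℝ}
    (hC : 0 ≤ C) (h : ∀ x, p (A.mulVec x) ≤ C * q x) : indNorm p q A ≤ C := by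
  refine Real.sSup_le ?_ hC
  rintro _ ⟨x, hx, rfl⟩
  simpa [show q x = 1 from hx] using h x

theorem le_indNorm (p : Seminorm ℝ (ι → ℝ)) (q : Seminorm ℝ (κ → ℝ))
    (hq : ∀ x, q x = 0 → x = 0) (A : Matrix ι κ ℝ) (x : κ → ℝ) :
    p (A.mulVec x) ≤ indNorm p q A * q x := by
  obtain ⟨C, -, hC⟩ := p.exists_bound_of_finiteDimensional q hq A.mulVecLin
  have hbdd : BddAbove ((fun x => p (A.mulVec x)) '' {x | q x = 1}) := by
    refine ⟨C, ?_⟩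
    rintro _ ⟨y, hy, rfl⟩
    simpa [show q y = 1 from hy] using hC y
  rcases (apply_nonneg q x).eq_or_lt with h0 | hpos
  · simp [hq x h0.symm]
  have h1 : q ((q x)⁻¹ • x) = 1 := by
    rw [map_smul_eq_mul, Real.norm_of_nonneg (inv_nonneg.2 hpos.le), inv_mul_cancel₀ hpos.ne']
  have h2 : p (A.mulVec ((q x)⁻¹ • x)) ≤ indNorm p q A := le_csSup hbdd ⟨_, h1, rfl⟩
  rw [Matrix.mulVec_smul, map_smul_eq_mul, Real.norm_of_nonneg (inv_nonneg.2 hpos.le),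
    inv_mul_le_iff₀ hpos] at h2
  linarith

/-- The matrix measure associated with a norm exists. -/
theorem exists_hasMatMeasure [DecidableEq ι] [Nonempty ι] (p : Seminorm ℝ (ι → ℝ))
    (hp : ∀ x, p x = 0 → x = 0) (A : Matrix ι ι ℝ) : ∃ μ, HasMatMeasure p A μ := by
  refine ⟨_, MonotoneOn.tendsto_nhdsGT ?_ ?_⟩
  · intro s hs t ht hst
    replace hs : 0 < s := hs
    replace ht : 0 < t := ht
    have hle : s / t ≤ 1 := (div_le_one ht).2 hst
    have hst0 : 0 ≤ s / t := by positivity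
    have key : indNorm p p (1 + s • A) ≤ (1 - s / t) + s / t * indNorm p p (1 + t • A) := by
      have hn := indNorm_nonneg p p (1 + t • A)
      refine indNorm_le (by nlinarith [mul_nonneg hst0 hn]) fun x => ?_
      have hx : (1 + s • A).mulVec x
          = (1 - s / t) • x + (s / t) • (1 + t • A).mulVec x := by
        simp only [Matrix.add_mulVec, Matrix.one_mulVec, Matrix.smul_mulVec, smul_add, smul_smul,
          div_mul_cancel₀ s ht.ne']
        module
      rw [hx]
      refine (map_add_le_add p _ _).trans ?_
      rw [map_smul_eq_mul, map_smul_eq_mul, Real.norm_of_nonneg hst0,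
        Real.norm_of_nonneg (sub_nonneg.2 hle)]
      nlinarith [mul_le_mul_of_nonneg_left (le_indNorm p p hp (1 + t • A) x) hst0]
    rw [div_le_div_iff₀ hs ht]
    have := mul_le_mul_of_nonneg_right key ht.le
    have h3 : ((1 - s / t) + s / t * indNorm p p (1 + t • A)) * t
        = t - s + s * indNorm p p (1 + t • A) := by field_simp
    linarith
  · refine ⟨-indNorm p p A, ?_⟩
    rintro _ ⟨ε, hε, rfl⟩
    replace hε : 0 < ε := hε
    obtain ⟨x, hx⟩ := exists_ne (0 : ι → ℝ)
    have hpos : 0 < p x := (apply_nonneg p x).lt_of_ne fun h => hx (hp x h.symm)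
    have h1 := le_indNorm p p hp (1 + ε • A) x
    have h2 := le_indNorm p p hp A x
    have h3 : p x ≤ p ((1 + ε • A).mulVec x) + ε * p (A.mulVec x) := by
      have := map_sub_le_add p ((1 + ε • A).mulVec x) (ε • A.mulVec x)
      rw [map_smul_eq_mul, Real.norm_of_nonneg hε.le] at this
      simpa [Matrix.add_mulVec, Matrix.smul_mulVec] using this
    have h4 : 1 ≤ indNorm p p (1 + ε • A) + ε * indNorm p p A := by
      refine le_of_mul_le_mul_right ?_ hpos
      nlinarith [mul_le_mul_of_nonneg_left h2 hε.le]
    simp only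
    rw [le_div_iff₀ hε]
    linarith

end IndNorm

section WeightedNorm

variable {ι : Type*} [Fintype ι] {n : ι → Type*} [∀ i, Fintype (n i)]

theorem sqrt_sum_sq_le_sqrt_sum_sq (D : ι → ℝ) {b c : ι → ℝ} (h : ∀ i, |b i| ≤ |c i|) :
    √(∑ i, (D i * b i) ^ 2) ≤ √(∑ i, (D i * c i) ^ 2) := by
  refine Real.sqrt_le_sqrt (Finset.sum_le_sum fun i _ => ?_)
  rw [mul_pow, mul_pow]
  exact mul_le_mul_of_nonneg_left (sq_le_sq.2 (h i)) (sq_nonneg _)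

theorem eq_zero_of_sqrt_sum_sq_eq_zero {D : ι → ℝ} (hD : ∀ i, 0 < D i) {b : ι → ℝ}
    (h : √(∑ i, (D i * b i) ^ 2) = 0) (i : ι) : b i = 0 := by
  have hn : ∀ i ∈ Finset.univ, 0 ≤ (D i * b i) ^ 2 := fun i _ => sq_nonneg _
  rw [Real.sqrt_eq_zero (Finset.sum_nonneg hn), Finset.sum_eq_zero_iff_of_nonneg hn] at h
  simpa [(hD i).ne'] using h i (Finset.mem_univ i)

/-- The norm `|b|_{D,2} = |D b|₂` for a diagonal weight `D`. -/
noncomputable def weightedSeminorm (D : ι → ℝ) : Seminorm ℝ (ι → ℝ) :=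
  Seminorm.of (fun b => √(∑ i, (D i * b i) ^ 2))
    (fun b c => by
      have := norm_add_le (WithLp.toLp 2 fun i => D i * b i) (WithLp.toLp 2 fun i => D i * c i)
      simpa [EuclideanSpace.norm_eq, mul_add, ← abs_mul, ← WithLp.toLp_add] using this)
    (fun r b => by
      have := norm_smul r (WithLp.toLp 2 fun i => D i * b i)
      simpa [EuclideanSpace.norm_eq, mul_left_comm, ← abs_mul] using this)

/-- The composite norm `|a|_* = |D (|a¹|∞, …, |aᵐ|∞)|₂`. -/
noncomputable def compositeSeminorm (D : ι → ℝ) : Seminorm ℝ ((Σ i, n i) → ℝ) :=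
  Seminorm.of (fun a => √(∑ i, (D i * ‖fun b : n i => a ⟨i, b⟩‖) ^ 2))
    (fun a c => by
      refine le_trans (sqrt_sum_sq_le_sqrt_sum_sq D
          (c := (fun i => ‖fun b : n i => a ⟨i, b⟩‖) + fun i => ‖fun b : n i => c ⟨i, b⟩‖)
          fun i => ?_)
        (map_add_le_add (weightedSeminorm D) _ _)
      rw [abs_of_nonneg (norm_nonneg _)]
      exact (norm_add_le (fun b : n i => a ⟨i, b⟩) fun b : n i => c ⟨i, b⟩).trans (le_abs_self _))
    (fun r a => by
      have h : ∀ i, ‖fun b : n i => (r • a) ⟨i, b⟩‖ = ‖r‖ * ‖fun b : n i => a ⟨i, b⟩‖ :=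
        fun i => norm_smul r fun b : n i => a ⟨i, b⟩
      have := map_smul_eq_mul (weightedSeminorm D) ‖r‖ fun i => ‖fun b : n i => a ⟨i, b⟩‖
      rw [norm_norm] at this
      simp only [h]
      exact this)

/-- The blocks of `(1 + ε A) a` are bounded by the reduced matrix `1 + ε B` applied to the vector of
block norms of `a`, up to the error of the first-order expansion of `‖1 + ε Aⁱⁱ‖`. -/
theorem norm_block_mulVec_le [DecidableEq ι] [∀ i, DecidableEq (n i)]
    (A : Matrix (Σ i, n i) (Σ i, n i) ℝ) (B : Matrix ι ι ℝ)
    (hB : ∀ i j, i ≠ j → B i j = indNorm (fun x : n i → ℝ => ‖x‖) (fun x : n j → ℝ => ‖x‖)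
      (fun a b => A ⟨i, a⟩ ⟨j, b⟩))
    {ε : ℝ} (hε : 0 ≤ ε) (a : (Σ i, n i) → ℝ) (i : ι) :
    ‖fun b : n i => (1 + ε • A).mulVec a ⟨i, b⟩‖ ≤
      (1 + ε • B).mulVec (fun j => ‖fun b : n j => a ⟨j, b⟩‖) i +
        (indNorm (fun x : n i → ℝ => ‖x‖) (fun x : n i → ℝ => ‖x‖)
          (1 + ε • show Matrix (n i) (n i) ℝ from fun a b => A ⟨i, a⟩ ⟨i, b⟩) - 1 - ε * B i i) *
          ‖fun b : n i => a ⟨i, b⟩‖ := by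
  let blk : ∀ i j, Matrix (n i) (n j) ℝ := fun i j a b => A ⟨i, a⟩ ⟨j, b⟩
  let v : ∀ j, n j → ℝ := fun j b => a ⟨j, b⟩
  have bound : ∀ i j (M : Matrix (n i) (n j) ℝ), ‖M.mulVec (v j)‖ ≤
      indNorm (fun x : n i → ℝ => ‖x‖) (fun x : n j → ℝ => ‖x‖) M * ‖v j‖ := fun i j M =>
    le_indNorm (normSeminorm ℝ (n i → ℝ)) (normSeminorm ℝ (n j → ℝ))
      (fun x hx => norm_eq_zero.1 hx) M (v j)
  have hsplit : (fun b : n i => (1 + ε • A).mulVec a ⟨i, b⟩) =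
      (1 + ε • blk i i).mulVec (v i) +
        ε • ∑ j ∈ Finset.univ.erase i, (blk i j).mulVec (v j) := by
    have hA : (fun b : n i => A.mulVec a ⟨i, b⟩) = ∑ j, (blk i j).mulVec (v j) := by
      ext b
      simp [Matrix.mulVec, dotProduct, Fintype.sum_sigma, blk, v]
    rw [← Finset.add_sum_erase _ _ (Finset.mem_univ i)] at hA
    ext b
    have := congrFun hA b
    simp only [Pi.add_apply] at this
    simp only [Matrix.add_mulVec, Matrix.one_mulVec, Matrix.smul_mulVec, Pi.add_apply,
      Pi.smul_apply, this, smul_eq_mul, v]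
    ring
  have hBv : (1 + ε • B).mulVec (fun j => ‖v j‖) i =
      ‖v i‖ + ε * (B i i * ‖v i‖ + ∑ j ∈ Finset.univ.erase i, B i j * ‖v j‖) := by
    rw [Finset.add_sum_erase _ (fun j => B i j * ‖v j‖) (Finset.mem_univ i)]
    rw [Matrix.add_mulVec, Matrix.smul_mulVec, Matrix.one_mulVec]
    rfl
  have hoff : ‖ε • ∑ j ∈ Finset.univ.erase i, (blk i j).mulVec (v j)‖ ≤
      ε * ∑ j ∈ Finset.univ.erase i, B i j * ‖v j‖ := by
    rw [norm_smul, Real.norm_of_nonneg hε]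
    refine mul_le_mul_of_nonneg_left (norm_sum_le_of_le _ fun j hj => ?_) hε
    rw [hB i j (Finset.ne_of_mem_erase hj).symm]
    exact bound i j (blk i j)
  have hdiag := bound i i (1 + ε • blk i i)
  rw [hsplit, hBv]
  refine (norm_add_le _ _).trans ((add_le_add hdiag hoff).trans (le_of_eq ?_))
  simp only [blk, v]
  ring

end WeightedNorm

/-- Ström's result: let `ℝⁿ` be decomposed into `m` blocks of sizes
`n₁, …, n_m ≥ 1` (realized here as the sigma type `Σ i : Fin m, Fin (ns i)`), and let
`A` be partitioned into blocks `A^{ij}` accordingly. If `B ∈ ℝ^{m×m}` has diagonal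
entries `B_{ii} = μ∞(A^{ii})` and off-diagonal entries `B_{ij} = ‖A^{ij}‖∞` (the
operator norm induced by the sup norms), then for every positive diagonal `D`, the
matrix measure `μ_*` associated with the composite norm
`|a|_* = |D(|a¹|∞, …, |aᵐ|∞)ᵀ|₂` satisfies `μ_*(A) ≤ μ_{D,2}(B)`, where `μ_{D,2}` is
associated with `|b|_{D,2} = |D b|₂`. -/
theorem statement15 (m : ℕ) (hm : 0 < m) (ns : Fin m → ℕ) (hns : ∀ i, 1 ≤ ns i)
    (A : Matrix ((i : Fin m) × Fin (ns i)) ((i : Fin m) × Fin (ns i)) ℝ)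
    (B : Matrix (Fin m) (Fin m) ℝ)
    (hBdiag : ∀ i : Fin m,
      HasMatMeasure (fun x : Fin (ns i) → ℝ => ‖x‖)
        (fun a b : Fin (ns i) => A ⟨i, a⟩ ⟨i, b⟩) (B i i))
    (hBoff : ∀ i j : Fin m, i ≠ j →
      B i j = indNorm (fun x : Fin (ns i) → ℝ => ‖x‖) (fun x : Fin (ns j) → ℝ => ‖x‖)
        (fun a b => A ⟨i, a⟩ ⟨j, b⟩))
    (D : Fin m → ℝ) (hD : ∀ i, 0 < D i) :
    ∃ μA μB : ℝ,
      HasMatMeasure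
        (fun a : ((i : Fin m) × Fin (ns i)) → ℝ =>
          Real.sqrt (∑ i : Fin m, (D i * ‖fun b : Fin (ns i) => a ⟨i, b⟩‖) ^ 2)) A μA ∧
      HasMatMeasure (fun b : Fin m → ℝ => Real.sqrt (∑ i, (D i * b i) ^ 2)) B μB ∧
      μA ≤ μB := by
  have : Nonempty (Fin m) := ⟨⟨0, hm⟩⟩
  have : Nonempty ((i : Fin m) × Fin (ns i)) := ⟨⟨⟨0, hm⟩, ⟨0, hns _⟩⟩⟩
  let q : Seminorm ℝ (((i : Fin m) × Fin (ns i)) → ℝ) := compositeSeminorm D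
  let w : Seminorm ℝ (Fin m → ℝ) := weightedSeminorm D
  have hw : ∀ x, w x = 0 → x = 0 := fun x hx => funext (eq_zero_of_sqrt_sum_sq_eq_zero hD hx)
  have hq : ∀ x, q x = 0 → x = 0 := fun x hx => funext fun ⟨i, b⟩ =>
    congrFun (norm_eq_zero.1 (eq_zero_of_sqrt_sum_sq_eq_zero hD hx i)) b
  obtain ⟨μA, hA⟩ := exists_hasMatMeasure q hq A
  obtain ⟨μB, hB⟩ := exists_hasMatMeasure w hw B
  refine ⟨μA, μB, hA, hB, ?_⟩
  let e : Fin m → ℝ → ℝ := fun i ε =>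
    indNorm (fun x : Fin (ns i) → ℝ => ‖x‖) (fun x : Fin (ns i) → ℝ => ‖x‖)
      (1 + ε • show Matrix (Fin (ns i)) (Fin (ns i)) ℝ from fun a b => A ⟨i, a⟩ ⟨i, b⟩)
  have herr : Filter.Tendsto (fun ε => ∑ i, |(e i ε - 1) / ε - B i i|)
      (nhdsWithin 0 (Set.Ioi 0)) (nhds 0) := by
    have := tendsto_finsetSum Finset.univ fun i _ => ((hBdiag i).sub_const (B i i)).abs
    simpa only [sub_self, abs_zero, Finset.sum_const_zero] using this
  have hlim := hB.add herr
  rw [add_zero] at hlim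
  refine le_of_tendsto_of_tendsto hA hlim ?_
  filter_upwards [self_mem_nhdsWithin] with ε hε
  replace hε : 0 < ε := hε
  set ρ := ∑ i, |(e i ε - 1) / ε - B i i| with hρ
  have hρ0 : 0 ≤ ρ := Finset.sum_nonneg fun i _ => abs_nonneg _
  have key : indNorm q q (1 + ε • A) ≤ indNorm w w (1 + ε • B) + ε * ρ := by
    refine indNorm_le (add_nonneg (indNorm_nonneg w w _) (by positivity)) fun a => ?_
    let N : Fin m → ℝ := fun j => ‖fun b : Fin (ns j) => a ⟨j, b⟩‖
    have hcomp : q ((1 + ε • A).mulVec a) ≤ w ((1 + ε • B).mulVec N + (ε * ρ) • N) := by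
      refine sqrt_sum_sq_le_sqrt_sum_sq D fun i => ?_
      rw [abs_of_nonneg (norm_nonneg _)]
      refine ((norm_block_mulVec_le A B hBoff hε.le a i).trans ?_).trans (le_abs_self _)
      refine add_le_add le_rfl (mul_le_mul_of_nonneg_right ?_ (norm_nonneg _))
      have h1 : (e i ε - 1) / ε - B i i ≤ ρ := (le_abs_self _).trans
        (Finset.single_le_sum (f := fun i => |(e i ε - 1) / ε - B i i|)
          (fun i _ => abs_nonneg _) (Finset.mem_univ i))
      calc e i ε - 1 - ε * B i i = ε * ((e i ε - 1) / ε - B i i) := by field_simp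
        _ ≤ ε * ρ := mul_le_mul_of_nonneg_left h1 hε.le
    refine (hcomp.trans (map_add_le_add w _ _)).trans ?_
    rw [map_smul_eq_mul, Real.norm_of_nonneg (by positivity : 0 ≤ ε * ρ), add_mul]
    exact add_le_add (le_indNorm w w hw _ N) le_rfl
  change (indNorm q q (1 + ε • A) - 1) / ε ≤ (indNorm w w (1 + ε • B) - 1) / ε + ρ
  rw [div_le_iff₀ hε, add_mul, div_mul_cancel₀ _ hε.ne']
  linarith
end
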